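/- arXiv:1904.12780 — 2 statements merged into one kernel-verified Lean document; each statement's English description precedes it below -/
import Mathlib

section
/- Let ρ ∈ (0,1) and W, Q be probability measures with D_ρ(W‖Q) < ∞, and let W_ρ^Q be the order-ρ tilted probability measure. Let W_ac denote the component of W absolutely continuous with respect to Q. Then W_ρ^Q-almost surely, ln(dW_ρ^Q/dW) − D_1(W_ρ^Q‖W) = (ρ−1)(ln(dW_ac/dQ) − E_{W_ρ^Q}[ln(dW_ac/dQ)]). -/
open MeasureTheory Real

/-- Integrand of the order-`ρ` Rényi divergence with respect to a dominating measure `ν`. -/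
noncomputable def renyiIntegrand {Y : Type*} [MeasurableSpace Y] (ρ : ℝ) (W Q ν : Measure Y)
    (y : Y) : ℝ :=
  ((W.rnDeriv ν y).toReal) ^ ρ * ((Q.rnDeriv ν y).toReal) ^ (1 - ρ)

/-- Order-`ρ` Rényi divergence `D_ρ(W‖Q)` computed via a dominating measure `ν`. -/
noncomputable def renyiDiv {Y : Type*} [MeasurableSpace Y] (ρ : ℝ) (W Q ν : Measure Y) : ℝ :=
  (ρ - 1)⁻¹ * Real.log (∫ y, renyiIntegrand ρ W Q ν y ∂ν)

/-- Kullback-Leibler divergence `D_1(μ‖ν) = ∫ log (dμ/dν) dμ` (real-valued version). -/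
noncomputable def klDiv' {Y : Type*} [MeasurableSpace Y] (μ ν : Measure Y) : ℝ :=
  ∫ y, Real.log ((μ.rnDeriv ν y).toReal) ∂μ

/-- Order-`ρ` tilted probability measure `W_ρ^Q`:
`dW_ρ^Q/dν = e^{(1-ρ) D_ρ(W‖Q)} (dW/dν)^ρ (dQ/dν)^{1-ρ}`. -/
noncomputable def tilted {Y : Type*} [MeasurableSpace Y] (ρ : ℝ) (W Q ν : Measure Y) :
    Measure Y :=
  ν.withDensity fun y =>
    ENNReal.ofReal (Real.exp ((1 - ρ) * renyiDiv ρ W Q ν) * renyiIntegrand ρ W Q ν y)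

section RenyiTilting

variable {Y : Type*} [MeasurableSpace Y] {ρ : ℝ} {W Q ν : Measure Y}

lemma rpow_mul_rpow_mul_abs_log_div_le (hρ : ρ ∈ Set.Ioo (0 : ℝ) 1) {w q : ℝ}
    (hw : 0 < w) (hq : 0 < q) :
    w ^ ρ * q ^ (1 - ρ) * |log (w / q)| ≤ w / (1 - ρ) + q / ρ := by
  have hρ0 : 0 < ρ := hρ.1
  have hρ1 : 0 < 1 - ρ := by linarith [hρ.2]
  have hm : 0 < w ^ ρ * q ^ (1 - ρ) := by positivity
  have hw' : w ^ ρ * w ^ (1 - ρ) = w := by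
    rw [← rpow_add hw, add_sub_cancel, rpow_one]
  have hq' : q ^ ρ * q ^ (1 - ρ) = q := by
    rw [← rpow_add hq, add_sub_cancel, rpow_one]
  have upper : w ^ ρ * q ^ (1 - ρ) * log (w / q) ≤ w / (1 - ρ) := by
    calc _ ≤ w ^ ρ * q ^ (1 - ρ) * ((w / q) ^ (1 - ρ) / (1 - ρ)) := by
          gcongr
          exact log_le_rpow_div (by positivity) hρ1
      _ = (w ^ ρ * w ^ (1 - ρ)) / (1 - ρ) := by
          rw [div_rpow hw.le hq.le]
          field_simp
      _ = w / (1 - ρ) := by rw [hw']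
  have lower : w ^ ρ * q ^ (1 - ρ) * log (q / w) ≤ q / ρ := by
    calc _ ≤ w ^ ρ * q ^ (1 - ρ) * ((q / w) ^ ρ / ρ) := by
          gcongr
          exact log_le_rpow_div (by positivity) hρ0
      _ = (q ^ ρ * q ^ (1 - ρ)) / ρ := by
          rw [div_rpow hq.le hw.le]
          field_simp
      _ = q / ρ := by rw [hq']
  have hw0 : 0 ≤ w / (1 - ρ) := by positivity
  have hq0 : 0 ≤ q / ρ := by positivity
  rw [← inv_div w q, log_inv] at lower
  rcases abs_cases (log (w / q)) with ⟨h, -⟩ | ⟨h, -⟩ <;> rw [h] <;> linarith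

lemma renyiIntegrand_nonneg (ρ : ℝ) (W Q ν : Measure Y) (y : Y) :
    0 ≤ renyiIntegrand ρ W Q ν y := by
  unfold renyiIntegrand
  positivity

lemma measurable_renyiIntegrand (ρ : ℝ) (W Q ν : Measure Y) :
    Measurable (renyiIntegrand ρ W Q ν) :=
  ((W.measurable_rnDeriv ν).ennreal_toReal.pow_const _).mul
    ((Q.measurable_rnDeriv ν).ennreal_toReal.pow_const _)

lemma exp_mul_renyiDiv (hρ : ρ ≠ 1) (hfin : 0 < ∫ y, renyiIntegrand ρ W Q ν y ∂ν) :
    exp ((1 - ρ) * renyiDiv ρ W Q ν) = (∫ y, renyiIntegrand ρ W Q ν y ∂ν)⁻¹ := by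
  have h : ρ - 1 ≠ 0 := sub_ne_zero.2 hρ
  rw [renyiDiv, ← mul_assoc, show (1 - ρ) * (ρ - 1)⁻¹ = -1 by field_simp; ring, neg_one_mul,
    exp_neg, exp_log hfin]

lemma measurable_tilted_density (ρ : ℝ) (W Q ν : Measure Y) :
    Measurable fun y => ENNReal.ofReal
      (exp ((1 - ρ) * renyiDiv ρ W Q ν) * renyiIntegrand ρ W Q ν y) :=
  ((measurable_renyiIntegrand ρ W Q ν).const_mul _).ennreal_ofReal

lemma isProbabilityMeasure_tilted (hρ : ρ ≠ 1)
    (hfin : 0 < ∫ y, renyiIntegrand ρ W Q ν y ∂ν) :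
    IsProbabilityMeasure (tilted ρ W Q ν) := by
  have hint : Integrable (renyiIntegrand ρ W Q ν) ν := .of_integral_ne_zero hfin.ne'
  constructor
  rw [tilted, withDensity_apply _ .univ, setLIntegral_univ,
    ← ofReal_integral_eq_lintegral_ofReal (hint.const_mul _)
      (.of_forall fun y => mul_nonneg (exp_pos _).le (renyiIntegrand_nonneg ρ W Q ν y)),
    integral_const_mul, exp_mul_renyiDiv hρ hfin, inv_mul_cancel₀ hfin.ne', ENNReal.ofReal_one]

lemma tilted_absolutelyContinuous (ρ : ℝ) (W Q ν : Measure Y) : tilted ρ W Q ν ≪ ν :=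
  withDensity_absolutelyContinuous _ _

lemma ae_tilted_of_ae {p : Y → Prop} (h : ∀ᵐ y ∂ν, 0 < renyiIntegrand ρ W Q ν y → p y) :
    ∀ᵐ y ∂(tilted ρ W Q ν), p y := by
  rw [tilted, ae_withDensity_iff (measurable_tilted_density ρ W Q ν)]
  filter_upwards [h] with y hy hne
  refine hy (pos_of_mul_pos_right ?_ (exp_pos ((1 - ρ) * renyiDiv ρ W Q ν)).le)
  simpa using hne

lemma rnDeriv_toReal_pos_of_renyiIntegrand_pos (hρ : ρ ∈ Set.Ioo (0 : ℝ) 1) {y : Y}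
    (hy : 0 < renyiIntegrand ρ W Q ν y) :
    0 < (W.rnDeriv ν y).toReal ∧ 0 < (Q.rnDeriv ν y).toReal := by
  constructor <;> refine lt_of_le_of_ne ENNReal.toReal_nonneg fun h => hy.ne' ?_
  · rw [renyiIntegrand, ← h, zero_rpow hρ.1.ne', zero_mul]
  · rw [renyiIntegrand, ← h, zero_rpow (sub_pos.2 hρ.2).ne', mul_zero]

lemma ae_tilted_rnDeriv_pos (hρ : ρ ∈ Set.Ioo (0 : ℝ) 1) :
    ∀ᵐ y ∂(tilted ρ W Q ν), 0 < (W.rnDeriv ν y).toReal ∧ 0 < (Q.rnDeriv ν y).toReal :=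
  ae_tilted_of_ae (.of_forall fun _ => rnDeriv_toReal_pos_of_renyiIntegrand_pos hρ)

lemma tilted_absolutelyContinuous_left [SigmaFinite W] [SigmaFinite ν]
    (hρ : ρ ∈ Set.Ioo (0 : ℝ) 1) : tilted ρ W Q ν ≪ W := by
  refine Measure.AbsolutelyContinuous.mk fun s _ hs => ?_
  rw [measure_eq_zero_iff_ae_notMem] at hs ⊢
  refine ae_tilted_of_ae ?_
  filter_upwards [Measure.ae_rnDeriv_ne_zero_imp_of_ae (ν := ν) hs] with y hy hpos
  exact hy (ENNReal.toReal_pos_iff.1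
    (rnDeriv_toReal_pos_of_renyiIntegrand_pos hρ hpos).1).1.ne'

lemma tilted_absolutelyContinuous_right [SigmaFinite Q] [SigmaFinite ν]
    (hρ : ρ ∈ Set.Ioo (0 : ℝ) 1) : tilted ρ W Q ν ≪ Q := by
  refine Measure.AbsolutelyContinuous.mk fun s _ hs => ?_
  rw [measure_eq_zero_iff_ae_notMem] at hs ⊢
  refine ae_tilted_of_ae ?_
  filter_upwards [Measure.ae_rnDeriv_ne_zero_imp_of_ae (ν := ν) hs] with y hy hpos
  exact hy (ENNReal.toReal_pos_iff.1
    (rnDeriv_toReal_pos_of_renyiIntegrand_pos hρ hpos).2).1.ne'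

lemma ae_tilted_rnDeriv_eq_div [SigmaFinite W] [SigmaFinite Q] [SigmaFinite ν]
    (hρ : ρ ∈ Set.Ioo (0 : ℝ) 1) (hW : W ≪ ν) (hQ : Q ≪ ν) :
    ∀ᵐ y ∂(tilted ρ W Q ν),
      (W.rnDeriv Q y).toReal = (W.rnDeriv ν y).toReal / (Q.rnDeriv ν y).toReal := by
  filter_upwards [(tilted_absolutelyContinuous_right hρ).ae_le (Measure.rnDeriv_eq_div hW hQ)]
    with y hy
  rw [hy, ENNReal.toReal_div]

lemma ae_log_rnDeriv_tilted [SigmaFinite W] [SigmaFinite Q] [SigmaFinite ν]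
    [SigmaFinite (tilted ρ W Q ν)]
    (hρ : ρ ∈ Set.Ioo (0 : ℝ) 1) (hW : W ≪ ν) (hQ : Q ≪ ν) :
    ∀ᵐ y ∂(tilted ρ W Q ν),
      log (((tilted ρ W Q ν).rnDeriv W y).toReal) =
        (1 - ρ) * renyiDiv ρ W Q ν + (ρ - 1) * log ((W.rnDeriv Q y).toReal) := by
  have hTν := tilted_absolutelyContinuous ρ W Q ν
  filter_upwards [(tilted_absolutelyContinuous_left hρ).ae_le (Measure.rnDeriv_eq_div hTν hW),
    hTν.ae_le (Measure.rnDeriv_withDensity ν (measurable_tilted_density ρ W Q ν)),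
    ae_tilted_rnDeriv_eq_div hρ hW hQ, ae_tilted_rnDeriv_pos hρ] with y hTW hT hWQ ⟨hw, hq⟩
  rw [← tilted] at hT
  rw [hTW, hWQ, hT, ENNReal.toReal_div, ENNReal.toReal_ofReal
    (mul_nonneg (exp_pos _).le (renyiIntegrand_nonneg ρ W Q ν y)), renyiIntegrand]
  have hwρ := (rpow_pos_of_pos hw ρ).ne'
  have hqρ := (rpow_pos_of_pos hq (1 - ρ)).ne'
  rw [log_div (mul_ne_zero (exp_pos _).ne' (mul_ne_zero hwρ hqρ)) hw.ne',
    log_mul (exp_pos _).ne' (mul_ne_zero hwρ hqρ), log_mul hwρ hqρ, log_exp, log_rpow hw,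
    log_rpow hq, log_div hw.ne' hq.ne']
  ring

lemma integrable_log_rnDeriv_tilted [IsFiniteMeasure W] [IsFiniteMeasure Q] [SigmaFinite ν]
    (hρ : ρ ∈ Set.Ioo (0 : ℝ) 1) (hW : W ≪ ν) (hQ : Q ≪ ν) :
    Integrable (fun y => log ((W.rnDeriv Q y).toReal)) (tilted ρ W Q ν) := by
  set g : Y → ℝ := fun y => log ((W.rnDeriv ν y).toReal / (Q.rnDeriv ν y).toReal) with hg
  have hgm : Measurable g :=
    ((W.measurable_rnDeriv ν).ennreal_toReal.div
      (Q.measurable_rnDeriv ν).ennreal_toReal).log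
  suffices h : Integrable g (tilted ρ W Q ν) by
    refine h.congr ?_
    filter_upwards [ae_tilted_rnDeriv_eq_div hρ hW hQ] with y hy
    rw [hy]
  rw [tilted, integrable_withDensity_iff_integrable_smul' (measurable_tilted_density ρ W Q ν)
    (.of_forall fun _ => ENNReal.ofReal_lt_top)]
  have hbound : Integrable (fun y => exp ((1 - ρ) * renyiDiv ρ W Q ν) *
      ((W.rnDeriv ν y).toReal / (1 - ρ) + (Q.rnDeriv ν y).toReal / ρ)) ν :=
    ((Measure.integrable_toReal_rnDeriv.div_const _).add
      (Measure.integrable_toReal_rnDeriv.div_const _)).const_mul _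
  refine hbound.mono'
    ((measurable_tilted_density ρ W Q ν).ennreal_toReal.smul hgm).aestronglyMeasurable
    (.of_forall fun y => ?_)
  have hr := renyiIntegrand_nonneg ρ W Q ν y
  rw [ENNReal.toReal_ofReal (mul_nonneg (exp_pos _).le hr), norm_smul, norm_eq_abs, norm_eq_abs,
    abs_of_nonneg (mul_nonneg (exp_pos _).le hr), mul_assoc]
  gcongr
  rcases hr.eq_or_lt with h0 | hpos
  · have := hρ.1
    have : 0 < 1 - ρ := sub_pos.2 hρ.2
    rw [← h0, zero_mul]
    positivity
  · obtain ⟨hw, hq⟩ := rnDeriv_toReal_pos_of_renyiIntegrand_pos hρ hpos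
    exact rpow_mul_rpow_mul_abs_log_div_le hρ hw hq

end RenyiTilting

/-- For `ρ ∈ (0,1)` and probability measures `W, Q` with finite `D_ρ(W‖Q)`,
`W_ρ^Q`-a.s. `ln(dW_ρ^Q/dW) − D_1(W_ρ^Q‖W) = (ρ−1)(ln(dW_ac/dQ) − E_{W_ρ^Q}[ln(dW_ac/dQ)])`. -/
theorem tilted_log_density_W {Y : Type*} [MeasurableSpace Y] (ρ : ℝ)
    (hρ : ρ ∈ Set.Ioo (0 : ℝ) 1) (W Q ν : Measure Y)
    [IsProbabilityMeasure W] [IsProbabilityMeasure Q] [SigmaFinite ν]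
    (hW : W ≪ ν) (hQ : Q ≪ ν)
    (hfin : 0 < ∫ y, renyiIntegrand ρ W Q ν y ∂ν) :
    ∀ᵐ y ∂(tilted ρ W Q ν),
      Real.log (((tilted ρ W Q ν).rnDeriv W y).toReal) - klDiv' (tilted ρ W Q ν) W =
        (ρ - 1) * (Real.log ((W.rnDeriv Q y).toReal) -
          ∫ z, Real.log ((W.rnDeriv Q z).toReal) ∂(tilted ρ W Q ν)) := by
  have := isProbabilityMeasure_tilted hρ.2.ne hfin
  have hlog := ae_log_rnDeriv_tilted hρ hW hQ
  have hkl : klDiv' (tilted ρ W Q ν) W = (1 - ρ) * renyiDiv ρ W Q ν +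
      (ρ - 1) * ∫ z, Real.log ((W.rnDeriv Q z).toReal) ∂(tilted ρ W Q ν) := by
    rw [klDiv', integral_congr_ae hlog, integral_add (integrable_const _)
      ((integrable_log_rnDeriv_tilted hρ hW hQ).const_mul _), integral_const, integral_const_mul,
      probReal_univ, one_smul]
  filter_upwards [hlog] with y hy
  rw [hy, hkl]
  ring
end

section
/- Let W(x) be the Gaussian channel with noise variance σ², let ρ ∈ (0,1), let θ_ρ = σ² + P/2 − σ²/(2ρ) + √((P/2 − σ²/(2ρ))² + Pσ²), and let V(x) be the order-ρ tilted channel of W(x) toward N(0,θ_ρ), i.e., the Gaussian with mean ρθ_ρ x/(ρθ_ρ + (1−ρ)σ²) and variance σ²θ_ρ/(ρθ_ρ + (1−ρ)σ²). Define the random variable Λ_x = ln(dW(x)/dN(0,θ_ρ)) − E_{V(x)}[ln(dW(x)/dN(0,θ_ρ))]. Then the variance of Λ_x under V(x) equals (θ_ρ − σ²)²/(2(ρθ_ρ + (1−ρ)σ²)²) + σ²θ_ρ x²/(ρθ_ρ + (1−ρ)σ²)³. -/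
open MeasureTheory ProbabilityTheory Real

/-- Differentiating the exponential moment `∫ yⁿ e^{ty}` of a centered Gaussian in `t`, when it is
known to have the form `p(t) e^{vt²/2}`. -/
lemma integral_pow_succ_mul_exp_gaussianReal {v : NNReal} {n : ℕ} {p p' : ℝ → ℝ}
    (h : ∀ t, ∫ y, y ^ n * exp (t * y) ∂gaussianReal 0 v = p t * exp (v * t ^ 2 / 2))
    (hp : ∀ t, HasDerivAt p (p' t) t) (t : ℝ) :
    ∫ y, y ^ (n + 1) * exp (t * y) ∂gaussianReal 0 v =
      (p' t + v * t * p t) * exp (v * t ^ 2 / 2) := by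
  have h₁ := hasDerivAt_integral_pow_mul_exp_real (X := fun y : ℝ => y) (μ := gaussianReal 0 v)
    (t := t) (by simp) n
  have h₂ : HasDerivAt (fun t : ℝ => (v : ℝ) * t ^ 2 / 2) (v * t) t := by
    refine ((((hasDerivAt_id t).pow 2).const_mul (v : ℝ)).div_const 2).congr_deriv ?_
    simp only [id]
    ring
  rw [funext h] at h₁
  rw [h₁.unique ((hp t).mul h₂.exp)]
  ring

/-- The second, third and fourth moments of a centered Gaussian. -/
lemma integral_pow_gaussianReal_zero (v : NNReal) :
    ∫ y, y ^ 2 ∂gaussianReal 0 v = v ∧ ∫ y, y ^ 3 ∂gaussianReal 0 v = 0 ∧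
      ∫ y, y ^ 4 ∂gaussianReal 0 v = 3 * (v : ℝ) ^ 2 := by
  have h0 (t : ℝ) : ∫ y, y ^ 0 * exp (t * y) ∂gaussianReal 0 v =
      (fun _ => 1) t * exp (v * t ^ 2 / 2) := by
    have := congrFun (mgf_fun_id_gaussianReal (μ := 0) (v := v)) t
    simpa [mgf] using this
  have h1 := integral_pow_succ_mul_exp_gaussianReal h0 (fun t => hasDerivAt_const t (1 : ℝ))
  have h2 := integral_pow_succ_mul_exp_gaussianReal (p := fun t => 0 + v * t * 1)
    (p' := fun _ => v) h1 (fun t => by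
      simpa using (hasDerivAt_id t).const_mul (v : ℝ))
  have h3 := integral_pow_succ_mul_exp_gaussianReal (p := fun t => v + v * t * (0 + v * t * 1))
    (p' := fun t => 2 * v ^ 2 * t) h2 (fun t => by
      have := (((hasDerivAt_id t).pow 2).const_mul ((v : ℝ) ^ 2)).const_add (v : ℝ)
      refine (this.congr_deriv ?_).congr_of_eventuallyEq (.of_forall fun s => ?_) <;>
        simp <;> ring)
  have h4 := integral_pow_succ_mul_exp_gaussianReal
    (p := fun t => 2 * v ^ 2 * t + v * t * (v + v * t * (0 + v * t * 1)))
    (p' := fun t => 3 * v ^ 2 + 3 * v ^ 3 * t ^ 2) h3 (fun t => by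
      have := ((hasDerivAt_id t).const_mul (3 * (v : ℝ) ^ 2)).add
        (((hasDerivAt_id t).pow 3).const_mul ((v : ℝ) ^ 3))
      refine (this.congr_deriv ?_).congr_of_eventuallyEq (.of_forall fun s => ?_) <;>
        simp <;> ring)
  refine ⟨?_, ?_, ?_⟩
  · simpa using h2 0
  · simpa using h3 0
  · simpa using h4 0

lemma integrable_pow_gaussianReal (m : ℝ) (v : NNReal) (n : ℕ) :
    Integrable (fun y : ℝ => y ^ n) (gaussianReal m v) :=
  integrable_pow_of_mem_interior_integrableExpSet (X := fun y : ℝ => y) (by simp) n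

lemma integral_quadratic_gaussianReal_zero (v : NNReal) (a b c : ℝ) :
    ∫ z, (a * z ^ 2 + b * z + c) ∂gaussianReal 0 v = a * v + c := by
  have i1 := (integrable_pow_gaussianReal 0 v 1).const_mul b
  have i2 := (integrable_pow_gaussianReal 0 v 2).const_mul a
  simp only [pow_one] at i1
  rw [integral_add (i2.fun_add i1) (integrable_const c), integral_add i2 i1, integral_const_mul,
    integral_const_mul, (integral_pow_gaussianReal_zero v).1]
  simp

lemma integral_sq_centered_quadratic_gaussianReal_zero (v : NNReal) (a b : ℝ) :
    ∫ z, (a * z ^ 2 + b * z - a * v) ^ 2 ∂gaussianReal 0 v =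
      2 * a ^ 2 * (v : ℝ) ^ 2 + b ^ 2 * v := by
  obtain ⟨-, m3, m4⟩ := integral_pow_gaussianReal_zero v
  have i1 := (integrable_pow_gaussianReal 0 v 1).const_mul (-2 * a * b * v)
  have i2 := (integrable_pow_gaussianReal 0 v 2).const_mul (b ^ 2 - 2 * a ^ 2 * v)
  have i3 := (integrable_pow_gaussianReal 0 v 3).const_mul (2 * a * b)
  have i4 := (integrable_pow_gaussianReal 0 v 4).const_mul (a ^ 2)
  have i0 := integrable_const (μ := gaussianReal 0 v) ((a * v) ^ 2)
  simp only [pow_one] at i1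
  calc ∫ z, (a * z ^ 2 + b * z - a * v) ^ 2 ∂gaussianReal 0 v
      = ∫ z, (a ^ 2 * z ^ 4 + 2 * a * b * z ^ 3 + ((b ^ 2 - 2 * a ^ 2 * v) * z ^ 2 +
          -2 * a * b * v * z + (a * v) ^ 2)) ∂gaussianReal 0 v := by
        congr 1 with z
        ring
    _ = 2 * a ^ 2 * (v : ℝ) ^ 2 + b ^ 2 * v := by
        rw [integral_add (i4.fun_add i3) ((i2.fun_add i1).fun_add i0), integral_add i4 i3,
          integral_quadratic_gaussianReal_zero, integral_const_mul, integral_const_mul, m3, m4]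
        ring

lemma integral_gaussianReal_eq_integral_zero_add (m : ℝ) (v : NNReal) (f : ℝ → ℝ) :
    ∫ y, f y ∂gaussianReal m v = ∫ z, f (z + m) ∂gaussianReal 0 v := by
  have h : gaussianReal m v = (gaussianReal 0 v).map (· + m) := by
    rw [gaussianReal_map_add_const, zero_add]
  rw [h, (measurableEmbedding_addRight m).integral_map]

/-- The variance of a quadratic polynomial, written around the mean, under a Gaussian. -/
lemma integral_sq_sub_integral_quadratic_gaussianReal (m : ℝ) (v : NNReal) (a b c : ℝ) (f : ℝ → ℝ)
    (hf : ∀ᵐ y ∂gaussianReal m v, f y = a * (y - m) ^ 2 + b * (y - m) + c) :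
    ∫ y, (f y - ∫ z, f z ∂gaussianReal m v) ^ 2 ∂gaussianReal m v =
      2 * a ^ 2 * (v : ℝ) ^ 2 + b ^ 2 * v := by
  have hmean : ∫ z, f z ∂gaussianReal m v = a * v + c := by
    rw [integral_congr_ae hf, integral_gaussianReal_eq_integral_zero_add]
    simpa using integral_quadratic_gaussianReal_zero v a b c
  have hsq : (fun y => (f y - ∫ z, f z ∂gaussianReal m v) ^ 2) =ᵐ[gaussianReal m v]
      fun y => (a * (y - m) ^ 2 + b * (y - m) - a * v) ^ 2 := by
    filter_upwards [hf] with y hy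
    rw [hy, hmean]
    ring
  rw [integral_congr_ae hsq, integral_gaussianReal_eq_integral_zero_add]
  simpa using integral_sq_centered_quadratic_gaussianReal_zero v a b

lemma log_gaussianPDFReal (m : ℝ) {v : NNReal} (hv : v ≠ 0) (y : ℝ) :
    log (gaussianPDFReal m v y) = -log (√(2 * π * v)) - (y - m) ^ 2 / (2 * v) := by
  have h : (0 : ℝ) < v := by positivity
  have h' : √(2 * π * v) ≠ 0 := by positivity
  rw [gaussianPDFReal, log_mul (inv_ne_zero h') (exp_ne_zero _), log_inv, log_exp]
  ring

/-- The log-likelihood ratio between two nondegenerate Gaussians. -/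
lemma log_rnDeriv_gaussianReal (m₁ m₂ : ℝ) {v₁ v₂ : NNReal} (h₁ : v₁ ≠ 0) (h₂ : v₂ ≠ 0) :
    ∀ᵐ y, log (((gaussianReal m₁ v₁).rnDeriv (gaussianReal m₂ v₂) y).toReal) =
      log (√(2 * π * v₂)) - log (√(2 * π * v₁)) +
        (y - m₂) ^ 2 / (2 * v₂) - (y - m₁) ^ 2 / (2 * v₁) := by
  have h := gaussianReal_absolutelyContinuous' m₂ h₂ (Measure.rnDeriv_eq_div
    (gaussianReal_absolutelyContinuous m₁ h₁) (gaussianReal_absolutelyContinuous m₂ h₂))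
  filter_upwards [h, rnDeriv_gaussianReal m₁ v₁, rnDeriv_gaussianReal m₂ v₂] with y hy hy₁ hy₂
  rw [hy, hy₁, hy₂, ENNReal.toReal_div, toReal_gaussianPDF, toReal_gaussianPDF,
    log_div (gaussianPDFReal_pos _ _ _ h₁).ne' (gaussianPDFReal_pos _ _ _ h₂).ne',
    log_gaussianPDFReal _ h₁, log_gaussianPDFReal _ h₂]
  ring

/-- Variance of the centered log-likelihood ratio of the Gaussian channel under the order-`ρ`
tilted measure: with `W(x) = N(x,σ²)`, `Q = N(0,θ_ρ)` and `V(x)` the tilted Gaussian,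
`Var_{V(x)}[Λ_x] = (θ_ρ − σ²)²/(2(ρθ_ρ+(1−ρ)σ²)²) + σ²θ_ρ x²/(ρθ_ρ+(1−ρ)σ²)³`. -/
theorem gaussian_tilted_variance (σ P ρ x θ : ℝ) (hσ : 0 < σ) (hP : 0 < P)
    (hρ : ρ ∈ Set.Ioo (0 : ℝ) 1)
    (hθ : θ = σ ^ 2 + P / 2 - σ ^ 2 / (2 * ρ) +
      Real.sqrt ((P / 2 - σ ^ 2 / (2 * ρ)) ^ 2 + P * σ ^ 2)) :
    let W := gaussianReal x (σ ^ 2).toNNReal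
    let Q := gaussianReal 0 θ.toNNReal
    let V := gaussianReal (ρ * θ * x / (ρ * θ + (1 - ρ) * σ ^ 2))
      (σ ^ 2 * θ / (ρ * θ + (1 - ρ) * σ ^ 2)).toNNReal
    let Λ := fun y : ℝ => Real.log ((W.rnDeriv Q y).toReal) -
      ∫ z, Real.log ((W.rnDeriv Q z).toReal) ∂V
    ∫ y, (Λ y) ^ 2 ∂V =
      (θ - σ ^ 2) ^ 2 / (2 * (ρ * θ + (1 - ρ) * σ ^ 2) ^ 2) +
        σ ^ 2 * θ * x ^ 2 / (ρ * θ + (1 - ρ) * σ ^ 2) ^ 3 := by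
  intro W Q V Λ
  have hs : 0 < σ ^ 2 := by positivity
  obtain ⟨hρ0, hρ1⟩ := hρ
  have hθ0 : 0 < θ := by
    have h : |P / 2 - σ ^ 2 / (2 * ρ)| ≤
        √((P / 2 - σ ^ 2 / (2 * ρ)) ^ 2 + P * σ ^ 2) :=
      abs_le_sqrt (by nlinarith [mul_pos hP hs])
    linarith [(abs_le.1 h).1]
  clear hθ
  set D : ℝ := ρ * θ + (1 - ρ) * σ ^ 2 with hD
  have hD0 : 0 < D := by
    have := mul_pos (sub_pos.2 hρ1) hs
    positivity
  have hv0 : 0 < σ ^ 2 * θ / D := by positivity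
  have key := integral_sq_sub_integral_quadratic_gaussianReal (ρ * θ * x / D)
    (σ ^ 2 * θ / D).toNNReal (1 / (2 * θ) - 1 / (2 * σ ^ 2)) (x / D)
    (log (√(2 * π * θ)) - log (√(2 * π * σ ^ 2)) +
      (ρ * θ * x / D) ^ 2 / (2 * θ) - (ρ * θ * x / D - x) ^ 2 / (2 * σ ^ 2))
    (fun y => log ((W.rnDeriv Q y).toReal)) (by
      refine gaussianReal_absolutelyContinuous _ (toNNReal_pos.2 hv0).ne' ?_
      filter_upwards [log_rnDeriv_gaussianReal x 0 (toNNReal_pos.2 hs).ne'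
        (toNNReal_pos.2 hθ0).ne'] with y hy
      rw [hy, coe_toNNReal _ hs.le, coe_toNNReal _ hθ0.le]
      have hb : x / D = ρ * θ * x / D / θ - (ρ * θ * x / D - x) / σ ^ 2 := by
        field_simp
        rw [hD]
        ring
      rw [hb]
      field_simp
      ring)
  refine key.trans ?_
  rw [coe_toNNReal _ hv0.le]
  field_simp
  ring
end
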